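/- arXiv:2103.11739 — 3 statements merged into one kernel-verified Lean document; each statement's English description precedes it below -/
import Mathlib

section
/- Let P, δ, r be real numbers with 0 < P, 0 < δ, P + δ < 1, and r > 0, and let ε := (1/r) · (-ln((P/(1-P)) · (1/(δ+P) - 1))). Then for every real P' with 0 ≤ P' < 1 satisfying the posterior-odds bound P'/(1-P') ≤ exp(ε·r) · P/(1-P), it holds that P' - P ≤ δ. (Proposition 1, guarantee direction: this ε achieves the guessing-advantage upper bound δ.) -/
theorem guessing_advantage_bound
    (P δ r : ℝ) (hP : 0 < P) (hδ : 0 < δ) (hPδ : P + δ < 1) (hr : 0 < r)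
    (ε : ℝ) (hε : ε = (1 / r) * (-Real.log ((P / (1 - P)) * (1 / (δ + P) - 1)))) :
    ∀ P' : ℝ, 0 ≤ P' → P' < 1 →
      P' / (1 - P') ≤ Real.exp (ε * r) * P / (1 - P) →
      P' - P ≤ δ := by
  intro P' _ hP'1 hodds
  have hP1 : 0 < 1 - P := by linarith
  have hsum : 0 < δ + P := by linarith
  have hrest : 0 < 1 - (δ + P) := by linarith
  have hfactor : 1 / (δ + P) - 1 = (1 - (δ + P)) / (δ + P) := by
    field_simp
  have hpos : 0 < (P / (1 - P)) * (1 / (δ + P) - 1) := by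
    rw [hfactor]; positivity
  have hexp : Real.exp (ε * r) = ((P / (1 - P)) * (1 / (δ + P) - 1))⁻¹ := by
    have hεr : ε * r = -Real.log ((P / (1 - P)) * (1 / (δ + P) - 1)) := by
      rw [hε]; field_simp
    rw [hεr, Real.exp_neg, Real.exp_log hpos]
  have hbound : Real.exp (ε * r) * P / (1 - P) = (δ + P) / (1 - (δ + P)) := by
    rw [hexp, hfactor]
    field_simp
  rw [hbound, div_le_div_iff₀ (by linarith) hrest] at hodds
  linarith
end

section
/- Let P and δ be real numbers with 0 < P, 0 < δ, and P + δ < 1, and let ε := -ln((P/(1-P)) · (1/(δ+P) - 1)). Then for every real ε' > ε, the posterior probability exp(ε')·P / (exp(ε')·P + (1-P)) is strictly greater than P + δ. (Proposition 1, maximality direction: ε is the maximum possible privacy parameter, i.e., the minimum noise, that keeps the guessing advantage at most δ.) -/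
theorem epsilon_maximality
    (P δ : ℝ) (hP : 0 < P) (hδ : 0 < δ) (hPδ : P + δ < 1)
    (ε : ℝ) (hε : ε = -Real.log ((P / (1 - P)) * (1 / (δ + P) - 1))) :
    ∀ ε' : ℝ, ε < ε' →
      Real.exp ε' * P / (Real.exp ε' * P + (1 - P)) > P + δ := by
  intro ε' hlt
  have hP' : 0 < 1 - P := by linarith
  have hS : 0 < δ + P := by linarith
  have hS' : 0 < 1 - (δ + P) := by linarith
  have hodds : (P / (1 - P)) * (1 / (δ + P) - 1)
      = P * (1 - (δ + P)) / ((1 - P) * (δ + P)) := by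
    field_simp
  have hexp : Real.exp ε = (1 - P) * (δ + P) / (P * (1 - (δ + P))) := by
    rw [hε, hodds, Real.exp_neg, Real.exp_log (by positivity), inv_div]
  have hlt' := Real.exp_lt_exp.mpr hlt
  rw [hexp, div_lt_iff₀ (by positivity)] at hlt'
  rw [gt_iff_lt, lt_div_iff₀ (by positivity)]
  linarith
end

section
/- Let δ be a real number with 0 < δ < 1. For every real P with 0 < P < 1 - δ, it holds that -ln((P/(1-P)) · (1/(δ+P) - 1)) ≥ 2 · ln((1+δ)/(1-δ)), with equality if and only if P = (1-δ)/2. In other words, the prior P = (1-δ)/2 is the worst case: it minimizes the admissible privacy parameter ε over all priors compatible with advantage bound δ. -/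
theorem sq_sub_odds_mul_eq {δ P : ℝ} (hδ : 1 + δ ≠ 0) (hP : 1 - P ≠ 0) (hδP : δ + P ≠ 0) :
    ((1 - δ) / (1 + δ)) ^ 2 - P / (1 - P) * (1 / (δ + P) - 1) =
      δ * (2 * P - (1 - δ)) ^ 2 / ((1 + δ) ^ 2 * ((1 - P) * (δ + P))) := by
  field_simp
  ring

theorem worst_case_prior_minimizes_epsilon
    (δ : ℝ) (hδ0 : 0 < δ) (hδ1 : δ < 1) :
    ∀ P : ℝ, 0 < P → P < 1 - δ →
      (-Real.log ((P / (1 - P)) * (1 / (δ + P) - 1)) ≥ 2 * Real.log ((1 + δ) / (1 - δ)) ∧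
        (-Real.log ((P / (1 - P)) * (1 / (δ + P) - 1)) = 2 * Real.log ((1 + δ) / (1 - δ)) ↔
          P = (1 - δ) / 2)) := by
  intro P hP0 hP1
  have hP : 0 < 1 - P := by linarith
  have hδP : 0 < δ + P := by linarith
  have hδ : 0 < 1 + δ := by linarith
  have hδ' : 0 < 1 - δ := by linarith
  have hid := sq_sub_odds_mul_eq hδ.ne' hP.ne' hδP.ne'
  have hX : 0 < P / (1 - P) * (1 / (δ + P) - 1) := by
    have : 1 < 1 / (δ + P) := by
      rw [lt_div_iff₀ hδP]
      linarith
    exact mul_pos (by positivity) (by linarith)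
  have hY : 0 < ((1 - δ) / (1 + δ)) ^ 2 := by positivity
  have hlog : 2 * Real.log ((1 + δ) / (1 - δ)) = -Real.log (((1 - δ) / (1 + δ)) ^ 2) := by
    rw [Real.log_pow, ← inv_div (1 - δ) (1 + δ), Real.log_inv]
    push_cast
    ring
  rw [hlog, ge_iff_le, neg_le_neg_iff, neg_inj, Real.log_le_log_iff hX hY]
  constructor
  · rw [← sub_nonneg, hid]
    positivity
  · rw [Real.log_injOn_pos.eq_iff hX hY, eq_comm, ← sub_eq_zero, hid, div_eq_zero_iff,
      or_iff_left (by positivity), mul_eq_zero, or_iff_right hδ0.ne', sq_eq_zero_iff, sub_eq_zero,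
      eq_div_iff two_ne_zero, mul_comm]
end
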